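/- (Theorem 3) Let ρ be a bipartite density matrix on nA × nB. Then the symmetric discord and the local coherences together bound the total coherence from below: Θ(ρ) + C(ρ^A) + C(ρ^B) ≤ C(ρ). -/

import Mathlib

open Matrix
open Kronecker
open scoped ComplexOrder

/-- Von Neumann entropy of a matrix (defined via its eigenvalues when it is Hermitian). -/
noncomputable def vN {n : Type*} [Fintype n] [DecidableEq n] (ρ : Matrix n n ℂ) : ℝ :=
  letI := Classical.propDecidable ρ.IsHermitian
  if h : ρ.IsHermitian then ∑ i, Real.negMulLog (h.eigenvalues i) else 0

/-- Full dephasing in the standard basis. -/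
noncomputable def deph {n : Type*} [Fintype n] [DecidableEq n] (ρ : Matrix n n ℂ) :
    Matrix n n ℂ := Matrix.diagonal fun i => ρ i i

/-- Relative entropy of coherence in the standard basis. -/
noncomputable def coh {n : Type*} [Fintype n] [DecidableEq n] (ρ : Matrix n n ℂ) : ℝ :=
  vN (deph ρ) - vN ρ

/-- Partial dephasing on the first (A) subsystem of a bipartite state. -/
noncomputable def dephA {nA nB : Type*} [Fintype nA] [DecidableEq nA]
    [Fintype nB] [DecidableEq nB] (ρ : Matrix (nA × nB) (nA × nB) ℂ) :
    Matrix (nA × nB) (nA × nB) ℂ :=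
  Matrix.of fun p q => if p.1 = q.1 then ρ p q else 0

/-- Reduced state on subsystem A. -/
noncomputable def redA {nA nB : Type*} [Fintype nA] [DecidableEq nA]
    [Fintype nB] [DecidableEq nB] (ρ : Matrix (nA × nB) (nA × nB) ℂ) : Matrix nA nA ℂ :=
  Matrix.of fun a a' => ∑ b, ρ (a, b) (a', b)

/-- Reduced state on subsystem B. -/
noncomputable def redB {nA nB : Type*} [Fintype nA] [DecidableEq nA]
    [Fintype nB] [DecidableEq nB] (ρ : Matrix (nA × nB) (nA × nB) ℂ) : Matrix nB nB ℂ :=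
  Matrix.of fun b b' => ∑ a, ρ (a, b) (a, b')

/-- Quantum mutual information of a bipartite state. -/
noncomputable def mi {nA nB : Type*} [Fintype nA] [DecidableEq nA]
    [Fintype nB] [DecidableEq nB] (ρ : Matrix (nA × nB) (nA × nB) ℂ) : ℝ :=
  vN (redA ρ) + vN (redB ρ) - vN ρ

/-- The action `(U ⊗ 1) ρ (U ⊗ 1)∗` of a local unitary on the A subsystem. -/
noncomputable def conjA {nA nB : Type*} [Fintype nA] [DecidableEq nA]
    [Fintype nB] [DecidableEq nB] (U : Matrix nA nA ℂ)
    (ρ : Matrix (nA × nB) (nA × nB) ℂ) : Matrix (nA × nB) (nA × nB) ℂ :=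
  (U ⊗ₖ (1 : Matrix nB nB ℂ)) * ρ * (U ⊗ₖ (1 : Matrix nB nB ℂ))ᴴ

theorem vN_eq_sum_negMulLog {n : Type*} [Fintype n] [DecidableEq n] {σ : Matrix n n ℂ}
    (h : σ.IsHermitian) : vN σ = ∑ i, Real.negMulLog (h.eigenvalues i) := by
  simp [vN, h]

theorem vN_le_card {n : Type*} [Fintype n] [DecidableEq n] {σ : Matrix n n ℂ}
    (h : σ.PosSemidef) : vN σ ≤ Fintype.card n := by
  rw [vN_eq_sum_negMulLog h.isHermitian]
  calc ∑ i, Real.negMulLog (h.isHermitian.eigenvalues i) ≤ ∑ _i : n, (1 : ℝ) :=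
        Finset.sum_le_sum fun i _ =>
          (Real.negMulLog_le_one_sub_self (h.eigenvalues_nonneg i)).trans
            (sub_le_self 1 (h.eigenvalues_nonneg i))
    _ = Fintype.card n := by simp

theorem vN_nonneg {n : Type*} [Fintype n] [DecidableEq n] {σ : Matrix n n ℂ}
    (h : σ.PosSemidef) (htr : σ.trace = 1) : 0 ≤ vN σ := by
  rw [vN_eq_sum_negMulLog h.isHermitian]
  have hsum : ∑ i, h.isHermitian.eigenvalues i = 1 := by
    have := h.isHermitian.trace_eq_sum_eigenvalues
    rw [htr] at this
    rw [← Complex.ofReal_inj, Complex.ofReal_sum]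
    simpa using this.symm
  exact Finset.sum_nonneg fun i _ => Real.negMulLog_nonneg (h.eigenvalues_nonneg i)
    (hsum ▸ Finset.single_le_sum (fun j _ => h.eigenvalues_nonneg j) (Finset.mem_univ i))

theorem posSemidef_deph {n : Type*} [Fintype n] [DecidableEq n] {σ : Matrix n n ℂ}
    (h : σ.PosSemidef) : (deph σ).PosSemidef :=
  Matrix.PosSemidef.diagonal fun _ => h.diag_nonneg

theorem trace_deph {n : Type*} [Fintype n] [DecidableEq n] (σ : Matrix n n ℂ) :
    (deph σ).trace = σ.trace := by
  simp [deph, Matrix.trace]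

theorem redA_deph {nA nB : Type*} [Fintype nA] [DecidableEq nA] [Fintype nB] [DecidableEq nB]
    (σ : Matrix (nA × nB) (nA × nB) ℂ) : redA (deph σ) = deph (redA σ) := by
  ext a a'
  by_cases h : a = a' <;> simp [redA, deph, Matrix.diagonal_apply, h]

theorem redB_deph {nA nB : Type*} [Fintype nA] [DecidableEq nA] [Fintype nB] [DecidableEq nB]
    (σ : Matrix (nA × nB) (nA × nB) ℂ) : redB (deph σ) = deph (redB σ) := by
  ext b b'
  by_cases h : b = b' <;> simp [redB, deph, Matrix.diagonal_apply, h]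

/-- The mutual information of a fully dephased state is bounded in terms of the dimensions. -/
theorem mi_deph_le_card_add_card {nA nB : Type*} [Fintype nA] [DecidableEq nA]
    [Fintype nB] [DecidableEq nB] {σ : Matrix (nA × nB) (nA × nB) ℂ}
    (h : σ.PosSemidef) (htr : σ.trace = 1) :
    mi (deph σ) ≤ Fintype.card nA + Fintype.card nB := by
  have hA : (redA (deph σ)).PosSemidef := by
    rw [redA_deph]
    exact Matrix.PosSemidef.diagonal fun a => Finset.sum_nonneg fun b _ => h.diag_nonneg
  have hB : (redB (deph σ)).PosSemidef := by
    rw [redB_deph]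
    exact Matrix.PosSemidef.diagonal fun b => Finset.sum_nonneg fun a _ => h.diag_nonneg
  have h₁ := vN_le_card hA
  have h₂ := vN_le_card hB
  have h₃ := vN_nonneg (posSemidef_deph h) ((trace_deph σ).trans htr)
  unfold mi
  linarith

/-- Measuring in the standard basis loses exactly the non-local part of the coherence. -/
theorem mi_sub_mi_deph {nA nB : Type*} [Fintype nA] [DecidableEq nA]
    [Fintype nB] [DecidableEq nB] (ρ : Matrix (nA × nB) (nA × nB) ℂ) :
    mi ρ - mi (deph ρ) = coh ρ - coh (redA ρ) - coh (redB ρ) := by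
  unfold mi coh
  rw [redA_deph, redB_deph]
  ring

/-- Theorem 3: `Θ(ρ) + C(ρ^A) + C(ρ^B) ≤ C(ρ)` for the symmetric discord `Θ`. -/
theorem symmetric_discord_add_local_coherences_le_coherence
    {nA nB : Type*} [Fintype nA] [DecidableEq nA] [Nonempty nA]
    [Fintype nB] [DecidableEq nB] [Nonempty nB]
    (ρ : Matrix (nA × nB) (nA × nB) ℂ) (hρ : ρ.PosSemidef) (htr : ρ.trace = 1) :
    (⨅ UV : Matrix.unitaryGroup nA ℂ × Matrix.unitaryGroup nB ℂ,
        (mi ρ - mi (deph (((UV.1 : Matrix nA nA ℂ) ⊗ₖ (UV.2 : Matrix nB nB ℂ)) * ρ *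
          ((UV.1 : Matrix nA nA ℂ) ⊗ₖ (UV.2 : Matrix nB nB ℂ))ᴴ))))
      + coh (redA ρ) + coh (redB ρ) ≤ coh ρ := by
  have hbdd : BddBelow (Set.range fun UV :
      Matrix.unitaryGroup nA ℂ × Matrix.unitaryGroup nB ℂ =>
        mi ρ - mi (deph (((UV.1 : Matrix nA nA ℂ) ⊗ₖ (UV.2 : Matrix nB nB ℂ)) * ρ *
          ((UV.1 : Matrix nA nA ℂ) ⊗ₖ (UV.2 : Matrix nB nB ℂ))ᴴ))) := by
    refine ⟨mi ρ - (Fintype.card nA + Fintype.card nB), ?_⟩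
    rintro _ ⟨⟨U, V⟩, rfl⟩
    refine sub_le_sub_left (mi_deph_le_card_add_card (hρ.mul_mul_conjTranspose_same _) ?_) _
    have hUV := Matrix.kronecker_mem_unitary U.2 V.2
    rw [Matrix.trace_mul_cycle, ← Matrix.star_eq_conjTranspose, hUV.1, one_mul, htr]
  have hle := ciInf_le hbdd (1, 1)
  simp only [OneMemClass.coe_one, Matrix.one_kronecker_one, one_mul,
    Matrix.conjTranspose_one, mul_one, mi_sub_mi_deph] at hle
  linarith
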